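/- Let n ≥ 1 and let p be a polynomial in one variable with complex coefficients. Then there exists a polynomial q in one variable with complex coefficients, with deg q ≤ deg p, such that the Fourier transform of the function x ↦ p(‖x‖²) e^{−π‖x‖²} on ℝ^n is the function t ↦ q(‖t‖²) e^{−π‖t‖²}. In other words, for each k the space 𝒫_k of functions of the form x ↦ p(‖x‖²) e^{−π‖x‖²} with deg p ≤ k is closed under the Fourier transform. -/

import Mathlib

open scoped FourierTransform

open MeasureTheory Module

namespace GaussianMoment

section InnerProductSpace

variable {V : Type*} [NormedAddCommGroup V]

/-- The monomial Gaussian `v ↦ ‖v‖ ^ (2 * k) e^{-b‖v‖²}`. -/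
noncomputable def powGaussian (k : ℕ) (b : ℂ) (v : V) : ℂ :=
  ((‖v‖ ^ 2 : ℝ) : ℂ) ^ k * Complex.exp (-b * ‖v‖ ^ 2)

lemma norm_powGaussian (k : ℕ) (b : ℂ) (v : V) :
    ‖powGaussian k b v‖ = (‖v‖ ^ 2) ^ k * Real.exp (-b.re * ‖v‖ ^ 2) := by
  have h : (-b * (‖v‖ : ℂ) ^ 2).re = -b.re * ‖v‖ ^ 2 := by
    rw [← Complex.ofReal_pow, Complex.re_mul_ofReal, Complex.neg_re]
  rw [powGaussian, norm_mul, norm_pow, Complex.norm_real, Complex.norm_exp, h,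
    Real.norm_of_nonneg (by positivity)]

lemma continuous_powGaussian (k : ℕ) (b : ℂ) : Continuous (powGaussian k b : V → ℂ) := by
  unfold powGaussian
  fun_prop

lemma hasDerivAt_powGaussian (k : ℕ) (b : ℂ) (v : V) :
    HasDerivAt (fun b ↦ powGaussian k b v) (-powGaussian (k + 1) b v) b := by
  have h := ((((hasDerivAt_id b).neg.mul_const ((‖v‖ : ℂ) ^ 2)).cexp).const_mul
    (((‖v‖ ^ 2 : ℝ) : ℂ) ^ k))
  convert! h using 1
  simp only [powGaussian, Pi.neg_apply, id]
  push_cast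
  ring

lemma pow_mul_exp_neg_le (k : ℕ) {c y : ℝ} (hc : 0 < c) (hy : 0 ≤ y) :
    y ^ k * Real.exp (-c * y) ≤ k.factorial / c ^ k := by
  have h := Real.pow_div_factorial_le_exp (c * y) (by positivity) k
  rw [div_le_iff₀ (by positivity), mul_pow] at h
  rw [neg_mul, Real.exp_neg, ← div_eq_mul_inv, div_le_div_iff₀ (by positivity) (by positivity)]
  linarith

variable [InnerProductSpace ℝ V] [FiniteDimensional ℝ V] [MeasurableSpace V] [BorelSpace V]

lemma integrable_pow_mul_exp (k : ℕ) {c : ℝ} (hc : 0 < c) :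
    Integrable (fun v : V ↦ (‖v‖ ^ 2) ^ k * Real.exp (-c * ‖v‖ ^ 2)) := by
  have h0 : Integrable (fun v : V ↦ Real.exp (-(c / 2) * ‖v‖ ^ 2)) := by
    have h := (GaussianFourier.integrable_cexp_neg_mul_sq_norm_add (V := V)
      (b := ((c / 2 : ℝ) : ℂ)) (by simpa using hc) 0 0).norm
    refine h.congr (.of_forall fun v ↦ ?_)
    simpa [powGaussian] using norm_powGaussian 0 ((c / 2 : ℝ) : ℂ) v
  refine (h0.const_mul (k.factorial / (c / 2) ^ k)).mono'
    (by fun_prop : Continuous _).aestronglyMeasurable (.of_forall fun v ↦ ?_)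
  rw [Real.norm_of_nonneg (by positivity)]
  calc (‖v‖ ^ 2) ^ k * Real.exp (-c * ‖v‖ ^ 2)
      = ((‖v‖ ^ 2) ^ k * Real.exp (-(c / 2) * ‖v‖ ^ 2)) * Real.exp (-(c / 2) * ‖v‖ ^ 2) := by
        rw [mul_assoc, ← Real.exp_add]
        ring_nf
    _ ≤ _ := by
        gcongr
        exact pow_mul_exp_neg_le k (half_pos hc) (by positivity)

lemma integrable_powGaussian (k : ℕ) {b : ℂ} (hb : 0 < b.re) :
    Integrable (powGaussian k b : V → ℂ) := by
  refine (integrable_pow_mul_exp k hb).mono' (continuous_powGaussian k b).aestronglyMeasurable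
    (.of_forall fun v ↦ (norm_powGaussian k b v).le)

lemma hasDerivAt_fourier_powGaussian (k : ℕ) {b : ℂ} (hb : 0 < b.re) (w : V) :
    HasDerivAt (fun b ↦ 𝓕 (powGaussian k b : V → ℂ) w)
      (-𝓕 (powGaussian (k + 1) b : V → ℂ) w) b := by
  simp only [Real.fourier_eq', ← integral_neg, ← smul_neg]
  have hcont (k : ℕ) (b : ℂ) : Continuous fun v : V ↦
      Complex.exp (↑(-2 * Real.pi * inner ℝ v w) * Complex.I) • powGaussian k b v := by
    have := continuous_powGaussian (V := V) k b
    fun_prop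
  have hnorm (k : ℕ) (b : ℂ) (v : V) :
      ‖Complex.exp (↑(-2 * Real.pi * inner ℝ v w) * Complex.I) • powGaussian k b v‖ =
        (‖v‖ ^ 2) ^ k * Real.exp (-b.re * ‖v‖ ^ 2) := by
    rw [norm_smul, Complex.norm_exp_ofReal_mul_I, one_mul, norm_powGaussian]
  refine (hasDerivAt_integral_of_dominated_loc_of_deriv_le
    (F' := fun z v ↦ Complex.exp (↑(-2 * Real.pi * inner ℝ v w) * Complex.I) •
      -powGaussian (k + 1) z v) (s := {z : ℂ | b.re / 2 < z.re})
    (bound := fun v ↦ (‖v‖ ^ 2) ^ (k + 1) * Real.exp (-(b.re / 2) * ‖v‖ ^ 2))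
    ?_ (.of_forall fun z ↦ (hcont k z).aestronglyMeasurable) ?_ ?_ ?_
    (integrable_pow_mul_exp (k + 1) (half_pos hb)) ?_).2
  · exact (isOpen_lt continuous_const Complex.continuous_re).mem_nhds (half_lt_self hb)
  · exact (integrable_pow_mul_exp k hb).mono' (hcont k b).aestronglyMeasurable
      (.of_forall fun v ↦ (hnorm k b v).le)
  · simp only [smul_neg]
    exact (hcont (k + 1) b).neg.aestronglyMeasurable
  · refine .of_forall fun v z hz ↦ ?_
    rw [smul_neg, norm_neg, hnorm]
    have hz' : b.re / 2 ≤ z.re := le_of_lt hz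
    gcongr
  · exact .of_forall fun v z _ ↦ (hasDerivAt_powGaussian k z v).const_mul _

end InnerProductSpace

open Polynomial in
/-- The polynomials describing the Fourier transforms of the monomial Gaussians, where `a` is half
the dimension of the space. -/
noncomputable def fourierPoly (a : ℂ) : ℕ → ℂ[X]
  | 0 => 1
  | k + 1 => C (a + k) * fourierPoly a k + X * derivative (fourierPoly a k)
      - C ((Real.pi : ℂ) ^ 2) * (X * fourierPoly a k)

lemma natDegree_fourierPoly_le (a : ℂ) (k : ℕ) : (fourierPoly a k).natDegree ≤ k := by
  induction k with
  | zero => simp [fourierPoly]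
  | succ k ih =>
    have hX (r : Polynomial ℂ) (hr : r.natDegree ≤ k) :
        (Polynomial.X * r).natDegree ≤ k + 1 := by
      refine Polynomial.natDegree_mul_le.trans ?_
      have := Polynomial.natDegree_X_le (R := ℂ)
      omega
    rw [fourierPoly]
    refine Polynomial.natDegree_sub_le_of_le
      (Polynomial.natDegree_add_le_of_degree_le (n := k + 1) ?_ ?_) ?_ |>.trans (max_self _).le
    · exact (Polynomial.natDegree_C_mul_le _ _).trans (ih.trans k.le_succ)
    · exact hX _ ((Polynomial.natDegree_derivative_le _).trans ((Nat.sub_le _ _).trans ih))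
    · exact (Polynomial.natDegree_C_mul_le _ _).trans (hX _ ih)

lemma hasDerivAt_cpow_mul_fourierPoly (a s : ℂ) (k : ℕ) {b : ℂ} (hb : 0 < b.re) :
    HasDerivAt (fun b : ℂ ↦ (Real.pi / b) ^ a * (b⁻¹ ^ k * (fourierPoly a k).eval (s * b⁻¹)) *
        Complex.exp (-Real.pi ^ 2 * s / b))
      (-((Real.pi / b) ^ a * (b⁻¹ ^ (k + 1) * (fourierPoly a (k + 1)).eval (s * b⁻¹)) *
        Complex.exp (-Real.pi ^ 2 * s / b))) b := by
  have hb0 : b ≠ 0 := by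
    rintro rfl
    simp at hb
  have hpi : (Real.pi : ℂ) ≠ 0 := by exact_mod_cast Real.pi_ne_zero
  have hinv := hasDerivAt_inv hb0
  have hslit : (Real.pi : ℂ) * b⁻¹ ∈ Complex.slitPlane := by
    left
    rw [Complex.re_ofReal_mul, Complex.inv_re]
    have := Complex.normSq_pos.2 hb0
    have := Real.pi_pos
    positivity
  have h1 := (hinv.const_mul (Real.pi : ℂ)).cpow_const (c := a) hslit
  have hpow : a * (Real.pi * b⁻¹) ^ (a - 1) * (Real.pi * -(b ^ 2)⁻¹) =
      -(a * (Real.pi * b⁻¹) ^ a * b⁻¹) := by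
    rw [Complex.cpow_sub _ _ (mul_ne_zero hpi (inv_ne_zero hb0)), Complex.cpow_one]
    field_simp
  rw [hpow] at h1
  have h2 := ((fourierPoly a k).hasDerivAt (s * b⁻¹)).comp b (hinv.const_mul s)
  have h3 := (hinv.const_mul (-(Real.pi : ℂ) ^ 2 * s)).cexp
  have h := (h1.mul ((hinv.pow k).mul h2)).mul h3
  simp only [div_eq_mul_inv]
  convert! h using 1
  simp only [fourierPoly, Polynomial.eval_sub, Polynomial.eval_add, Polynomial.eval_mul,
    Polynomial.eval_C, Polynomial.eval_X, Function.comp_apply, Pi.mul_apply, Pi.pow_apply,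
    ← inv_pow]
  cases k <;> push_cast <;> ring

variable {V : Type*} [NormedAddCommGroup V] [InnerProductSpace ℝ V] [FiniteDimensional ℝ V]
  [MeasurableSpace V] [BorelSpace V]

theorem fourier_powGaussian (k : ℕ) {b : ℂ} (hb : 0 < b.re) (w : V) :
    𝓕 (powGaussian k b : V → ℂ) w = (Real.pi / b) ^ (finrank ℝ V / 2 : ℂ) *
      (b⁻¹ ^ k * (fourierPoly (finrank ℝ V / 2) k).eval ((‖w‖ : ℂ) ^ 2 * b⁻¹)) *
        Complex.exp (-Real.pi ^ 2 * ‖w‖ ^ 2 / b) := by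
  induction k generalizing b with
  | zero =>
    have h0 : (powGaussian 0 b : V → ℂ) = fun v ↦ Complex.exp (-b * ‖v‖ ^ 2) := by
      ext v
      simp [powGaussian]
    simpa [h0, fourierPoly] using fourier_gaussian_innerProductSpace hb w
  | succ k ih =>
    have hev : (fun b ↦ 𝓕 (powGaussian k b : V → ℂ) w) =ᶠ[nhds b] _ :=
      Filter.eventuallyEq_of_mem
        ((isOpen_lt continuous_const Complex.continuous_re).mem_nhds hb) fun z hz ↦ ih hz
    exact neg_injective ((hasDerivAt_fourier_powGaussian k hb w).unique
      ((hasDerivAt_cpow_mul_fourierPoly _ _ k hb).congr_of_eventuallyEq hev))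

open Polynomial in
/-- The polynomial `q` such that `x ↦ p(‖x‖²) e^{-π‖x‖²}` has Fourier transform
`t ↦ q(‖t‖²) e^{-π‖t‖²}`, where `a` is half the dimension of the space. -/
noncomputable def fourierTransformPoly (a : ℂ) (p : ℂ[X]) : ℂ[X] :=
  ∑ k ∈ p.support, C (p.coeff k * (Real.pi : ℂ)⁻¹ ^ k) *
    (fourierPoly a k).comp (C (Real.pi : ℂ)⁻¹ * X)

lemma degree_fourierTransformPoly_le (a : ℂ) (p : Polynomial ℂ) :
    (fourierTransformPoly a p).degree ≤ p.degree := by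
  refine (Polynomial.degree_sum_le _ _).trans (Finset.sup_le fun k hk ↦ ?_)
  refine le_trans ?_ (Polynomial.le_degree_of_mem_supp k hk)
  refine Polynomial.degree_le_of_natDegree_le ((Polynomial.natDegree_C_mul_le _ _).trans ?_)
  refine Polynomial.natDegree_comp_le.trans ?_
  calc _ ≤ k * 1 := Nat.mul_le_mul (natDegree_fourierPoly_le a k)
        ((Polynomial.natDegree_C_mul_le _ _).trans Polynomial.natDegree_X_le)
    _ = k := mul_one k

theorem fourier_eval_mul_gaussian (p : Polynomial ℂ) (w : V) :
    𝓕 (fun x : V ↦ p.eval ((‖x‖ ^ 2 : ℝ) : ℂ) * Complex.exp (-Real.pi * ‖x‖ ^ 2)) w =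
      (fourierTransformPoly (finrank ℝ V / 2) p).eval ((‖w‖ ^ 2 : ℝ) : ℂ) *
        Complex.exp (-Real.pi * ‖w‖ ^ 2) := by
  have hpi : (Real.pi : ℂ) ≠ 0 := by exact_mod_cast Real.pi_ne_zero
  have hre : 0 < (Real.pi : ℂ).re := by simpa using Real.pi_pos
  have hexp : -(Real.pi : ℂ) ^ 2 * ‖w‖ ^ 2 / Real.pi = -Real.pi * ‖w‖ ^ 2 := by
    field_simp
  have hsum (x : V) : p.eval ((‖x‖ ^ 2 : ℝ) : ℂ) * Complex.exp (-Real.pi * ‖x‖ ^ 2) =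
      ∑ k ∈ p.support, p.coeff k * powGaussian k Real.pi x := by
    rw [Polynomial.eval_eq_sum, Polynomial.sum, Finset.sum_mul]
    simp only [powGaussian, mul_assoc]
  have hcomm (z : Circle) (c g : ℂ) : z • (c * g) = c * z • g := by
    simp only [Circle.smul_def, smul_eq_mul, mul_left_comm]
  have hF (k : ℕ) := fourier_powGaussian k hre w
  simp only [hexp, div_self hpi, Complex.one_cpow, one_mul] at hF
  simp only [Real.fourier_eq] at hF ⊢
  simp only [hsum, Finset.smul_sum, hcomm]
  rw [integral_finsetSum _ fun k _ ↦ ((Real.fourierIntegral_convergent_iff w).2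
    (integrable_powGaussian k hre)).const_mul _]
  simp only [integral_const_mul, hF, fourierTransformPoly, Polynomial.eval_finsetSum,
    Finset.sum_mul]
  refine Finset.sum_congr rfl fun k _ ↦ ?_
  simp only [Polynomial.eval_mul, Polynomial.eval_C, Polynomial.eval_comp, Polynomial.eval_X,
    Complex.ofReal_pow, mul_comm ((‖w‖ : ℂ) ^ 2)]
  ring

end GaussianMoment

/-- The Fourier transform of `x ↦ p(‖x‖²) e^{-π‖x‖²}` on ℝⁿ is `t ↦ q(‖t‖²) e^{-π‖t‖²}`
for some polynomial `q` with `deg q ≤ deg p`; in particular the space of such functions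
with `deg p ≤ k` is closed under the Fourier transform. -/
theorem fourier_polynomial_gaussian (n : ℕ) (hn : 1 ≤ n) (p : Polynomial ℂ) :
    ∃ q : Polynomial ℂ, q.degree ≤ p.degree ∧
      ∀ t : EuclideanSpace ℝ (Fin n),
        𝓕 (fun x : EuclideanSpace ℝ (Fin n) =>
            p.eval ((‖x‖ ^ 2 : ℝ) : ℂ) * Complex.exp (-Real.pi * ‖x‖ ^ 2)) t =
          q.eval ((‖t‖ ^ 2 : ℝ) : ℂ) * Complex.exp (-Real.pi * ‖t‖ ^ 2) := by
  exact ⟨_, GaussianMoment.degree_fourierTransformPoly_le _ p,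
    GaussianMoment.fourier_eval_mul_gaussian p⟩
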